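/- arXiv:1909.11978 — 8 statements merged into one kernel-verified Lean document; each statement's English description precedes it below -/
import Mathlib

section
/- Let A be a real n×n matrix, C a real m×n matrix, L a real n×m matrix, P a symmetric positive definite real n×n matrix such that vᵀ(P*(A − L*C))v < 0 for every nonzero v ∈ ℝ^n (so that A − L*C is invertible), and θ a symmetric positive semidefinite real m×m matrix. Then for every v ∈ ℝ^n, vᵀ(Cᵀ*θ*C*(A − L*C)⁻¹*P⁻¹*Cᵀ*θ*C)v ≤ 0; equivalently, for γ ≥ 0 the matrix −γ • (Cᵀ*θ*C*(A − L*C)⁻¹*P⁻¹*Cᵀ*θ*C) has nonnegative quadratic form. (Claim (18) in the proof of Theorem 2.) -/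
open Matrix

/-- A real matrix with negative definite quadratic form is invertible. -/
theorem isUnit_det_of_dotProduct_mulVec_neg {ι : Type*} [Fintype ι] [DecidableEq ι]
    {M : Matrix ι ι ℝ} (hM : ∀ v : ι → ℝ, v ≠ 0 → v ⬝ᵥ (M *ᵥ v) < 0) : IsUnit M.det := by
  rw [isUnit_iff_ne_zero]
  intro h
  obtain ⟨v, hv, hv0⟩ := Matrix.exists_mulVec_eq_zero_iff.mpr h
  simpa [hv0] using hM v hv

/-- The inverse of a real matrix with negative definite quadratic form has nonpositive
quadratic form. -/
theorem dotProduct_inv_mulVec_nonpos {ι : Type*} [Fintype ι] [DecidableEq ι]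
    {M : Matrix ι ι ℝ} (hM : ∀ v : ι → ℝ, v ≠ 0 → v ⬝ᵥ (M *ᵥ v) < 0) (w : ι → ℝ) :
    w ⬝ᵥ (M⁻¹ *ᵥ w) ≤ 0 := by
  have hw : M *ᵥ (M⁻¹ *ᵥ w) = w := by
    rw [mulVec_mulVec, mul_nonsing_inv _ (isUnit_det_of_dotProduct_mulVec_neg hM), one_mulVec]
  by_cases h : M⁻¹ *ᵥ w = 0
  · simp [h]
  · have := hM _ h
    rw [hw, dotProduct_comm] at this
    exact this.le

/-- Claim (18) in the proof of Theorem 2: the quadratic form of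
`Cᵀ*θ*C*(A − L*C)⁻¹*P⁻¹*Cᵀ*θ*C` is nonpositive, equivalently for `γ ≥ 0` the
matrix `−γ • (Cᵀ*θ*C*(A − L*C)⁻¹*P⁻¹*Cᵀ*θ*C)` has nonnegative quadratic form. -/
theorem cubic_observer_claim18 {n m : ℕ}
    (A P : Matrix (Fin n) (Fin n) ℝ) (C : Matrix (Fin m) (Fin n) ℝ)
    (L : Matrix (Fin n) (Fin m) ℝ) (θ : Matrix (Fin m) (Fin m) ℝ)
    (hPsymm : Pᵀ = P)
    (hPpos : ∀ v : Fin n → ℝ, v ≠ 0 → 0 < v ⬝ᵥ (P *ᵥ v))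
    (hLyap : ∀ v : Fin n → ℝ, v ≠ 0 → v ⬝ᵥ ((P * (A - L * C)) *ᵥ v) < 0)
    (hθsymm : θᵀ = θ)
    (hθpsd : ∀ w : Fin m → ℝ, 0 ≤ w ⬝ᵥ (θ *ᵥ w)) :
    (∀ v : Fin n → ℝ,
      v ⬝ᵥ ((Cᵀ * θ * C * (A - L * C)⁻¹ * P⁻¹ * Cᵀ * θ * C) *ᵥ v) ≤ 0) ∧
    (∀ γ : ℝ, 0 ≤ γ → ∀ v : Fin n → ℝ,
      0 ≤ v ⬝ᵥ (((-γ) • (Cᵀ * θ * C * (A - L * C)⁻¹ * P⁻¹ * Cᵀ * θ * C)) *ᵥ v)) := by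
  have key : ∀ v : Fin n → ℝ,
      v ⬝ᵥ ((Cᵀ * θ * C * (A - L * C)⁻¹ * P⁻¹ * Cᵀ * θ * C) *ᵥ v) ≤ 0 := by
    intro v
    have hS : (Cᵀ * θ * C)ᵀ = Cᵀ * θ * C := by
      simp only [transpose_mul, transpose_transpose, hθsymm, Matrix.mul_assoc]
    have hprod : Cᵀ * θ * C * (A - L * C)⁻¹ * P⁻¹ * Cᵀ * θ * C =
        (Cᵀ * θ * C)ᵀ * ((P * (A - L * C))⁻¹ * (Cᵀ * θ * C)) := by
      rw [hS, Matrix.mul_inv_rev]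
      simp only [Matrix.mul_assoc]
    rw [hprod, ← mulVec_mulVec, ← mulVec_mulVec, dotProduct_mulVec, vecMul_transpose]
    exact dotProduct_inv_mulVec_nonpos hLyap _
  refine ⟨key, fun γ hγ v => ?_⟩
  rw [smul_mulVec, dotProduct_smul, smul_eq_mul]
  exact mul_nonneg_of_nonpos_of_nonpos (neg_nonpos.mpr hγ) (key v)
end

section
/- Let A be a real n×n matrix, C a real m×n matrix, L a real n×m matrix, P a symmetric positive definite real n×n matrix with (A − L*C)ᵀP + P*(A − L*C) negative definite, θ a symmetric positive semidefinite real m×m matrix, and γ > 0 a real number. Define N = −γ • (P⁻¹ * Cᵀ * θ). Then the only equilibrium of the cubic observer error dynamics is the origin: the only vector v ∈ ℝ^n satisfying (A − L*C) *ᵥ v + (v ⬝ᵥ ((Cᵀ*θ*C) *ᵥ v)) • ((N*C) *ᵥ v) = 0 is v = 0. (Theorem 2: the gain N = −γP⁻¹Cᵀθ fulfills the unique-equilibrium condition (11).) -/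
open Matrix

/-- A matrix whose quadratic form is positive away from the origin is invertible. -/
theorem Matrix.isUnit_det_of_dotProduct_mulVec_pos {ι : Type*} [Fintype ι] [DecidableEq ι]
    {P : Matrix ι ι ℝ} (hP : ∀ v : ι → ℝ, v ≠ 0 → 0 < v ⬝ᵥ (P *ᵥ v)) : IsUnit P.det := by
  refine isUnit_iff_ne_zero.2 fun hdet => ?_
  obtain ⟨v, hv, hPv⟩ := Matrix.exists_mulVec_eq_zero_iff.2 hdet
  simpa [hPv] using hP v hv

/-- The Lyapunov form `Fᵀ * P + P * F` of a symmetric `P` is twice the form of `P * F`. -/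
theorem Matrix.dotProduct_lyapunov_mulVec {ι : Type*} [Fintype ι]
    {P : Matrix ι ι ℝ} (hP : Pᵀ = P) (F : Matrix ι ι ℝ) (v : ι → ℝ) :
    v ⬝ᵥ ((Fᵀ * P + P * F) *ᵥ v) = 2 * (v ⬝ᵥ (P *ᵥ (F *ᵥ v))) := by
  have htr : v ⬝ᵥ ((Fᵀ * P) *ᵥ v) = v ⬝ᵥ ((P * F) *ᵥ v) := by
    rw [← Matrix.dotProduct_transpose_mulVec, Matrix.transpose_mul, Matrix.transpose_transpose, hP]
  rw [Matrix.add_mulVec, dotProduct_add, htr, Matrix.mulVec_mulVec, two_mul]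

/-- Theorem 2 (unique equilibrium): with the gain `N = -γ • (P⁻¹ * Cᵀ * θ)`, the
only equilibrium of the cubic observer error dynamics is the origin. -/
theorem cubic_observer_unique_equilibrium {n m : ℕ}
    (A P : Matrix (Fin n) (Fin n) ℝ) (C : Matrix (Fin m) (Fin n) ℝ)
    (L : Matrix (Fin n) (Fin m) ℝ) (θ : Matrix (Fin m) (Fin m) ℝ) (γ : ℝ)
    (hPsymm : Pᵀ = P)
    (hPpos : ∀ v : Fin n → ℝ, v ≠ 0 → 0 < v ⬝ᵥ (P *ᵥ v))
    (hLyap : ∀ v : Fin n → ℝ, v ≠ 0 →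
      v ⬝ᵥ (((A - L * C)ᵀ * P + P * (A - L * C)) *ᵥ v) < 0)
    (hθsymm : θᵀ = θ)
    (hθpsd : ∀ w : Fin m → ℝ, 0 ≤ w ⬝ᵥ (θ *ᵥ w))
    (hγ : 0 < γ)
    (N : Matrix (Fin n) (Fin m) ℝ)
    (hN : N = (-γ) • (P⁻¹ * Cᵀ * θ)) :
    ∀ v : Fin n → ℝ,
      (A - L * C) *ᵥ v + (v ⬝ᵥ ((Cᵀ * θ * C) *ᵥ v)) • ((N * C) *ᵥ v) = 0 →
      v = 0 := by
  intro v hv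
  by_contra hne
  have hdet := Matrix.isUnit_det_of_dotProduct_mulVec_pos hPpos
  have hPN : P * (N * C) = (-γ) • (Cᵀ * θ * C) := by
    rw [hN, Matrix.smul_mul, Matrix.mul_smul, Matrix.mul_assoc P⁻¹, Matrix.mul_assoc P⁻¹,
      Matrix.mul_nonsing_inv_cancel_left _ _ hdet]
  have hform := congrArg (fun w => v ⬝ᵥ (P *ᵥ w)) hv
  simp only [Matrix.mulVec_add, Matrix.mulVec_smul, Matrix.mulVec_mulVec v P (N * C), hPN,
    Matrix.smul_mulVec, dotProduct_add, dotProduct_smul, smul_eq_mul, Matrix.mulVec_zero,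
    dotProduct_zero] at hform
  have hneg := hLyap v hne
  rw [Matrix.dotProduct_lyapunov_mulVec hPsymm] at hneg
  nlinarith [mul_nonneg hγ.le (sq_nonneg (v ⬝ᵥ ((Cᵀ * θ * C) *ᵥ v)))]
end

section
/- Let A be a real n×n matrix, C a real m×n matrix, L a real n×m matrix, P a symmetric positive definite real n×n matrix with (A − L*C)ᵀP + P*(A − L*C) negative definite, θ a symmetric positive semidefinite real m×m matrix, γ > 0, and N = −γ • (P⁻¹ * Cᵀ * θ). Let e : ℝ → (Fin n → ℝ) be any solution of the cubic observer error dynamics, i.e. for all t, e has derivative f(e(t)) at t, where f(e) = (A − L*C) *ᵥ e + (e ⬝ᵥ ((Cᵀ*θ*C) *ᵥ e)) • ((N*C) *ᵥ e). Then at every time t₀ with e(t₀) ≠ 0, the Lyapunov function V(t) = e(t) ⬝ᵥ (P *ᵥ e(t)) has a strictly negative derivative at t₀. (Theorem 2: the gain N = −γP⁻¹Cᵀθ yields a strictly decreasing Lyapunov function for the cubic observer.) -/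
open Matrix

theorem Matrix.isUnit_det_of_forall_dotProduct_mulVec_pos {n : ℕ} {P : Matrix (Fin n) (Fin n) ℝ}
    (hP : ∀ v : Fin n → ℝ, v ≠ 0 → 0 < v ⬝ᵥ (P *ᵥ v)) : IsUnit P.det := by
  rw [isUnit_iff_ne_zero]
  intro h
  obtain ⟨v, hv, hPv⟩ := Matrix.exists_mulVec_eq_zero_iff.mpr h
  simpa [hPv] using hP v hv

theorem HasDerivAt.dotProduct {n : ℕ} {f g : ℝ → Fin n → ℝ} {f' g' : Fin n → ℝ} {t : ℝ}
    (hf : HasDerivAt f f' t) (hg : HasDerivAt g g' t) :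
    HasDerivAt (fun s => f s ⬝ᵥ g s) (f' ⬝ᵥ g t + f t ⬝ᵥ g') t := by
  simp only [_root_.dotProduct, ← Finset.sum_add_distrib]
  exact HasDerivAt.fun_sum fun i _ => (hasDerivAt_pi.mp hf i).mul (hasDerivAt_pi.mp hg i)

theorem HasDerivAt.const_mulVec {n : ℕ} (P : Matrix (Fin n) (Fin n) ℝ)
    {f : ℝ → Fin n → ℝ} {f' : Fin n → ℝ} {t : ℝ} (hf : HasDerivAt f f' t) :
    HasDerivAt (fun s => P *ᵥ f s) (P *ᵥ f') t :=
  P.mulVecLin.toContinuousLinearMap.hasFDerivAt.comp_hasDerivAt t hf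

/-- Theorem 2: with the gain `N = -γ • (P⁻¹ * Cᵀ * θ)`, along any solution of the
cubic observer error dynamics the Lyapunov function `V(t) = e(t)ᵀ P e(t)` has
strictly negative derivative whenever the error is nonzero. -/
theorem cubic_observer_thm2_lyapunov_decreasing {n m : ℕ}
    (A P : Matrix (Fin n) (Fin n) ℝ) (C : Matrix (Fin m) (Fin n) ℝ)
    (L : Matrix (Fin n) (Fin m) ℝ) (θ : Matrix (Fin m) (Fin m) ℝ) (γ : ℝ)
    (hPsymm : Pᵀ = P)
    (hPpos : ∀ v : Fin n → ℝ, v ≠ 0 → 0 < v ⬝ᵥ (P *ᵥ v))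
    (hLyap : ∀ v : Fin n → ℝ, v ≠ 0 →
      v ⬝ᵥ (((A - L * C)ᵀ * P + P * (A - L * C)) *ᵥ v) < 0)
    (hθsymm : θᵀ = θ)
    (hθpsd : ∀ w : Fin m → ℝ, 0 ≤ w ⬝ᵥ (θ *ᵥ w))
    (hγ : 0 < γ)
    (N : Matrix (Fin n) (Fin m) ℝ)
    (hN : N = (-γ) • (P⁻¹ * Cᵀ * θ))
    (e : ℝ → (Fin n → ℝ))
    (hsol : ∀ t : ℝ, HasDerivAt e
      ((A - L * C) *ᵥ (e t) +
        ((e t) ⬝ᵥ ((Cᵀ * θ * C) *ᵥ (e t))) • ((N * C) *ᵥ (e t))) t) :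
    ∀ t₀ : ℝ, e t₀ ≠ 0 →
      deriv (fun t => (e t) ⬝ᵥ (P *ᵥ (e t))) t₀ < 0 := by
  intro t₀ he
  rw [((hsol t₀).dotProduct ((hsol t₀).const_mulVec P)).deriv]
  have hdet := isUnit_det_of_forall_dotProduct_mulVec_pos hPpos
  have hPN : P * (N * C) = (-γ) • (Cᵀ * θ * C) := by
    rw [hN, Matrix.smul_mul, Matrix.mul_smul, Matrix.mul_assoc P⁻¹, Matrix.mul_assoc P⁻¹,
      Matrix.mul_nonsing_inv_cancel_left _ _ hdet]
  have hsymm (u v : Fin n → ℝ) : u ⬝ᵥ (P *ᵥ v) = v ⬝ᵥ (P *ᵥ u) := by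
    rw [dotProduct_mulVec, ← mulVec_transpose, hPsymm, dotProduct_comm]
  generalize e t₀ = x at he ⊢
  have hL := hLyap x he
  have htr : x ⬝ᵥ (((A - L * C)ᵀ * P) *ᵥ x) = x ⬝ᵥ ((P * (A - L * C)) *ᵥ x) := by
    rw [← mulVec_mulVec, ← mulVec_mulVec, dotProduct_mulVec, vecMul_transpose, hsymm]
  rw [add_mulVec, dotProduct_add, htr] at hL
  rw [hsymm _ x, mulVec_add, mulVec_smul, mulVec_mulVec, mulVec_mulVec, hPN, smul_mulVec,
    dotProduct_add, dotProduct_smul, dotProduct_smul, smul_eq_mul, smul_eq_mul]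
  nlinarith [mul_nonneg hγ.le (sq_nonneg (x ⬝ᵥ ((Cᵀ * θ * C) *ᵥ x)))]
end

section
/- Let A be a real n×n matrix, C a real m×n matrix, L and N real n×m matrices, θ a symmetric positive semidefinite real m×m matrix, and P a symmetric positive definite real n×n matrix such that (A − L*C)ᵀP + P*(A − L*C) is negative definite and P*N*C + Cᵀ*Nᵀ*P is negative semidefinite. Let e : ℝ → (Fin n → ℝ) be any solution of the cubic observer error dynamics e' = f(e), where f(e) = (A − L*C) *ᵥ e + (e ⬝ᵥ ((Cᵀ*θ*C) *ᵥ e)) • ((N*C) *ᵥ e). Then the Zubov-type Lyapunov function W(t) = 1 − exp(−(e(t) ⬝ᵥ (P *ᵥ e(t)))) satisfies 0 ≤ W(t) < 1 for all t, and at every time t₀ with e(t₀) ≠ 0, W has strictly negative derivative at t₀. (Remark 2: Theorem 1 established via the Zubov function V = 1 − exp(−eᵀPe).) -/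
open Matrix

theorem HasDerivAt.dotProduct_mulVec {ι κ : Type*} [Fintype ι] [Fintype κ]
    (P : Matrix ι κ ℝ) {u : ℝ → ι → ℝ} {v : ℝ → κ → ℝ} {u' : ι → ℝ} {v' : κ → ℝ} {t : ℝ}
    (hu : HasDerivAt u u' t) (hv : HasDerivAt v v' t) :
    HasDerivAt (fun s => u s ⬝ᵥ (P *ᵥ v s)) (u' ⬝ᵥ (P *ᵥ v t) + u t ⬝ᵥ (P *ᵥ v')) t := by
  rw [hasDerivAt_pi] at hu hv
  have hPv : ∀ i, HasDerivAt (fun s => (P *ᵥ v s) i) ((P *ᵥ v') i) t := fun i =>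
    HasDerivAt.fun_sum fun j _ => (hv j).const_mul (P i j)
  have h : HasDerivAt (fun s => ∑ i, u s i * (P *ᵥ v s) i)
      (∑ i, (u' i * (P *ᵥ v t) i + u t i * (P *ᵥ v') i)) t :=
    HasDerivAt.fun_sum fun i _ => (hu i).mul (hPv i)
  rwa [Finset.sum_add_distrib] at h

theorem Matrix.dotProduct_transpose_mul_add_mul_mulVec {ι : Type*} [Fintype ι]
    (M P : Matrix ι ι ℝ) (v : ι → ℝ) :
    v ⬝ᵥ ((Mᵀ * P + P * M) *ᵥ v) = (M *ᵥ v) ⬝ᵥ (P *ᵥ v) + v ⬝ᵥ (P *ᵥ (M *ᵥ v)) := by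
  rw [add_mulVec, dotProduct_add, ← mulVec_mulVec, ← mulVec_mulVec, dotProduct_mulVec v Mᵀ,
    vecMul_transpose]

/-- Remark 2: the Zubov-type Lyapunov function `W(t) = 1 − exp(−e(t)ᵀ P e(t))`
satisfies `0 ≤ W < 1` and has strictly negative derivative whenever the error is
nonzero. -/
theorem cubic_observer_zubov {n m : ℕ}
    (A P : Matrix (Fin n) (Fin n) ℝ) (C : Matrix (Fin m) (Fin n) ℝ)
    (L N : Matrix (Fin n) (Fin m) ℝ) (θ : Matrix (Fin m) (Fin m) ℝ)
    (hθsymm : θᵀ = θ)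
    (hθpsd : ∀ w : Fin m → ℝ, 0 ≤ w ⬝ᵥ (θ *ᵥ w))
    (hPsymm : Pᵀ = P)
    (hPpos : ∀ v : Fin n → ℝ, v ≠ 0 → 0 < v ⬝ᵥ (P *ᵥ v))
    (hLyap : ∀ v : Fin n → ℝ, v ≠ 0 →
      v ⬝ᵥ (((A - L * C)ᵀ * P + P * (A - L * C)) *ᵥ v) < 0)
    (hNsd : ∀ v : Fin n → ℝ, v ⬝ᵥ ((P * N * C + Cᵀ * Nᵀ * P) *ᵥ v) ≤ 0)
    (e : ℝ → (Fin n → ℝ))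
    (hsol : ∀ t : ℝ, HasDerivAt e
      ((A - L * C) *ᵥ (e t) +
        ((e t) ⬝ᵥ ((Cᵀ * θ * C) *ᵥ (e t))) • ((N * C) *ᵥ (e t))) t) :
    (∀ t : ℝ, 0 ≤ 1 - Real.exp (-((e t) ⬝ᵥ (P *ᵥ (e t)))) ∧
      1 - Real.exp (-((e t) ⬝ᵥ (P *ᵥ (e t)))) < 1) ∧
    (∀ t₀ : ℝ, e t₀ ≠ 0 →
      deriv (fun t => 1 - Real.exp (-((e t) ⬝ᵥ (P *ᵥ (e t))))) t₀ < 0) := by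
  have hV : ∀ v : Fin n → ℝ, 0 ≤ v ⬝ᵥ (P *ᵥ v) := fun v => by
    rcases eq_or_ne v 0 with rfl | hv
    · simp
    · exact (hPpos v hv).le
  refine ⟨fun t => ⟨?_, ?_⟩, fun t₀ ht₀ => ?_⟩
  · have := Real.exp_le_one_iff.2 (neg_nonpos.2 (hV (e t)))
    linarith
  · have := Real.exp_pos (-((e t) ⬝ᵥ (P *ᵥ (e t))))
    linarith
  · have hW := (((hsol t₀).dotProduct_mulVec P (hsol t₀)).fun_neg.exp).const_sub 1
    rw [hW.deriv]
    have hlin := hLyap (e t₀) ht₀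
    rw [dotProduct_transpose_mul_add_mul_mulVec] at hlin
    have hcub := hNsd (e t₀)
    rw [add_comm, ← transpose_mul, Matrix.mul_assoc P N C,
      dotProduct_transpose_mul_add_mul_mulVec] at hcub
    have hq : 0 ≤ (e t₀) ⬝ᵥ ((Cᵀ * θ * C) *ᵥ (e t₀)) := by
      rw [← mulVec_mulVec, ← mulVec_mulVec, dotProduct_mulVec _ Cᵀ, vecMul_transpose]
      exact hθpsd _
    have hE := Real.exp_pos (-((e t₀) ⬝ᵥ (P *ᵥ (e t₀))))
    simp only [add_dotProduct, smul_dotProduct, mulVec_add, mulVec_smul, dotProduct_add,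
      dotProduct_smul, smul_eq_mul]
    have hqc := mul_nonpos_of_nonneg_of_nonpos hq hcub
    rw [neg_lt_zero]
    apply mul_pos hE
    linarith
end

section
/- Let A be a real n×n matrix, C a real m×n matrix, L and N real n×m matrices, θ a symmetric positive semidefinite real m×m matrix, ρ > 0, and P a symmetric positive definite real n×n matrix such that (A − L*C)ᵀP + P*(A − L*C) = −ρ • (1 : Matrix (Fin n) (Fin n) ℝ) and P*N*C + Cᵀ*Nᵀ*P is negative semidefinite. For e ∈ ℝ^n, define the cubic Lyapunov derivative V̇_c(e) = e ⬝ᵥ (((A − L*C)ᵀP + P*(A − L*C)) *ᵥ e) + (e ⬝ᵥ ((Cᵀ*θ*C) *ᵥ e)) * (e ⬝ᵥ ((P*N*C + Cᵀ*Nᵀ*P) *ᵥ e)) and the linear Lyapunov derivative V̇_l(e) = e ⬝ᵥ (((A − L*C)ᵀP + P*(A − L*C)) *ᵥ e) = −ρ * (e ⬝ᵥ e). Then for any e_c, e_l ∈ ℝ^n with e_c ⬝ᵥ e_c = e_l ⬝ᵥ e_l, one has V̇_c(e_c) ≤ V̇_l(e_l). (Theorem 3: at equal error norms the cubic observer's Lyapunov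 function descends at least as fast as the linear observer's.) -/
open Matrix

/-- Theorem 3: if `(A − LC)ᵀP + P(A − LC) = −ρI`, then at equal error norms the
cubic observer's Lyapunov derivative is at most the linear observer's. -/
theorem cubic_observer_thm3 {n m : ℕ}
    (A P : Matrix (Fin n) (Fin n) ℝ) (C : Matrix (Fin m) (Fin n) ℝ)
    (L N : Matrix (Fin n) (Fin m) ℝ) (θ : Matrix (Fin m) (Fin m) ℝ) (ρ : ℝ)
    (hρ : 0 < ρ)
    (hθsymm : θᵀ = θ)
    (hθpsd : ∀ w : Fin m → ℝ, 0 ≤ w ⬝ᵥ (θ *ᵥ w))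
    (hPsymm : Pᵀ = P)
    (hPpos : ∀ v : Fin n → ℝ, v ≠ 0 → 0 < v ⬝ᵥ (P *ᵥ v))
    (hLyap : (A - L * C)ᵀ * P + P * (A - L * C)
      = (-ρ) • (1 : Matrix (Fin n) (Fin n) ℝ))
    (hNsd : ∀ v : Fin n → ℝ, v ⬝ᵥ ((P * N * C + Cᵀ * Nᵀ * P) *ᵥ v) ≤ 0) :
    ∀ e_c e_l : Fin n → ℝ, e_c ⬝ᵥ e_c = e_l ⬝ᵥ e_l →
      e_c ⬝ᵥ ((((A - L * C)ᵀ * P + P * (A - L * C))) *ᵥ e_c) +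
        (e_c ⬝ᵥ ((Cᵀ * θ * C) *ᵥ e_c)) *
          (e_c ⬝ᵥ ((P * N * C + Cᵀ * Nᵀ * P) *ᵥ e_c))
      ≤ e_l ⬝ᵥ ((((A - L * C)ᵀ * P + P * (A - L * C))) *ᵥ e_l) := by
  intro e_c e_l hnorm
  have hθC : 0 ≤ e_c ⬝ᵥ ((Cᵀ * θ * C) *ᵥ e_c) := by
    rw [← mulVec_mulVec, ← mulVec_mulVec, dotProduct_mulVec, vecMul_transpose]
    exact hθpsd _
  have hcubic := mul_nonpos_of_nonneg_of_nonpos hθC (hNsd e_c)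
  rw [hLyap]
  simp only [smul_mulVec, one_mulVec, dotProduct_smul, hnorm]
  linarith
end

section
/- Let A be a real n×n matrix, C a real m×n matrix, L and N real n×m matrices, θ a symmetric positive semidefinite real m×m matrix, and P, Q symmetric positive definite real n×n matrices with (A − L*C)ᵀP + P*(A − L*C) = −Q and P*N*C + Cᵀ*Nᵀ*P negative semidefinite. Let λ_min(Q) denote the smallest eigenvalue of Q and λ_max(P) the largest eigenvalue of P. If ε is a real number with ε < λ_min(Q) / (2 * λ_max(P)), then for every nonzero e ∈ ℝ^n, −(e ⬝ᵥ (Q *ᵥ e)) + (e ⬝ᵥ ((Cᵀ*θ*C) *ᵥ e)) * (e ⬝ᵥ ((P*N*C + Cᵀ*Nᵀ*P) *ᵥ e)) + 2*ε*(e ⬝ᵥ (P *ᵥ e)) < 0; i.e. the Lyapunov derivative of the cubic observer error dynamics for the perturbed state matrix A + ε•I is strictly negative at every nonzero error. (Theorem 5: robustness of the cubic observer to scalar perturbations A(ε) = A + εI with bound (23).) -/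
open Matrix

namespace Matrix.IsHermitian

variable {ι : Type*} [Fintype ι] [DecidableEq ι] {M : Matrix ι ι ℝ}

theorem dotProduct_mulVec_eq_sum_eigenvalues (hM : M.IsHermitian) (v : ι → ℝ) :
    v ⬝ᵥ (M *ᵥ v) =
      ∑ i, hM.eigenvalues i * ((hM.eigenvectorUnitary : Matrix ι ι ℝ)ᵀ *ᵥ v) i ^ 2 := by
  set U : Matrix ι ι ℝ := (hM.eigenvectorUnitary : Matrix ι ι ℝ) with hU
  have hspec : M = U * diagonal hM.eigenvalues * Uᵀ := by
    have h := hM.spectral_theorem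
    rw [Unitary.conjStarAlgAut_apply] at h
    exact h
  have hform : v ⬝ᵥ (M *ᵥ v) = (Uᵀ *ᵥ v) ⬝ᵥ (diagonal hM.eigenvalues *ᵥ (Uᵀ *ᵥ v)) := by
    conv_lhs => rw [hspec]
    rw [← mulVec_mulVec, ← mulVec_mulVec, dotProduct_mulVec, ← mulVec_transpose]
  rw [hform, dotProduct]
  refine Finset.sum_congr rfl fun i _ => ?_
  rw [mulVec_diagonal]
  ring

theorem sum_sq_eigenvectorUnitary_transpose_mulVec (hM : M.IsHermitian) (v : ι → ℝ) :
    ∑ i, ((hM.eigenvectorUnitary : Matrix ι ι ℝ)ᵀ *ᵥ v) i ^ 2 = v ⬝ᵥ v := by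
  set U : Matrix ι ι ℝ := (hM.eigenvectorUnitary : Matrix ι ι ℝ) with hU
  have hunit : U * Uᵀ = 1 := Unitary.mul_star_self_of_mem hM.eigenvectorUnitary.2
  have hform : (Uᵀ *ᵥ v) ⬝ᵥ (Uᵀ *ᵥ v) = v ⬝ᵥ v := by
    conv_lhs => rw [mulVec_transpose, ← dotProduct_mulVec, ← mulVec_transpose, mulVec_mulVec,
      hunit, one_mulVec]
  rw [← hform, dotProduct]
  exact Finset.sum_congr rfl fun i _ => sq _

theorem iInf_eigenvalues_mul_le (hM : M.IsHermitian) (v : ι → ℝ) :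
    (⨅ i, hM.eigenvalues i) * (v ⬝ᵥ v) ≤ v ⬝ᵥ (M *ᵥ v) := by
  rw [hM.dotProduct_mulVec_eq_sum_eigenvalues,
    ← hM.sum_sq_eigenvectorUnitary_transpose_mulVec v, Finset.mul_sum]
  gcongr with i
  exact ciInf_le (Set.finite_range _).bddBelow i

theorem le_iSup_eigenvalues_mul (hM : M.IsHermitian) (v : ι → ℝ) :
    v ⬝ᵥ (M *ᵥ v) ≤ (⨆ i, hM.eigenvalues i) * (v ⬝ᵥ v) := by
  rw [hM.dotProduct_mulVec_eq_sum_eigenvalues,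
    ← hM.sum_sq_eigenvectorUnitary_transpose_mulVec v, Finset.mul_sum]
  gcongr with i
  exact le_ciSup (Set.finite_range _).bddAbove i

end Matrix.IsHermitian

/-- Theorem 5: if `ε < λ_min(Q) / (2 λ_max(P))`, then the Lyapunov derivative of
the cubic observer error dynamics for the perturbed state matrix `A + εI` is
strictly negative at every nonzero error. -/
theorem cubic_observer_thm5_robust {n m : ℕ}
    (A : Matrix (Fin n) (Fin n) ℝ) (C : Matrix (Fin m) (Fin n) ℝ)
    (L N : Matrix (Fin n) (Fin m) ℝ) (θ : Matrix (Fin m) (Fin m) ℝ)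
    (P Q : Matrix (Fin n) (Fin n) ℝ)
    (hθsymm : θᵀ = θ)
    (hθpsd : ∀ w : Fin m → ℝ, 0 ≤ w ⬝ᵥ (θ *ᵥ w))
    (hP : P.IsHermitian)
    (hPpos : ∀ v : Fin n → ℝ, v ≠ 0 → 0 < v ⬝ᵥ (P *ᵥ v))
    (hQ : Q.IsHermitian)
    (hQpos : ∀ v : Fin n → ℝ, v ≠ 0 → 0 < v ⬝ᵥ (Q *ᵥ v))
    (hLyap : (A - L * C)ᵀ * P + P * (A - L * C) = -Q)
    (hNsd : ∀ v : Fin n → ℝ, v ⬝ᵥ ((P * N * C + Cᵀ * Nᵀ * P) *ᵥ v) ≤ 0)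
    (ε : ℝ)
    (hε : ε < (⨅ i, hQ.eigenvalues i) / (2 * ⨆ i, hP.eigenvalues i)) :
    ∀ e : Fin n → ℝ, e ≠ 0 →
      -(e ⬝ᵥ (Q *ᵥ e)) +
        (e ⬝ᵥ ((Cᵀ * θ * C) *ᵥ e)) * (e ⬝ᵥ ((P * N * C + Cᵀ * Nᵀ * P) *ᵥ e)) +
        2 * ε * (e ⬝ᵥ (P *ᵥ e)) < 0 := by
  intro e he
  have hcubic : (e ⬝ᵥ ((Cᵀ * θ * C) *ᵥ e)) *
      (e ⬝ᵥ ((P * N * C + Cᵀ * Nᵀ * P) *ᵥ e)) ≤ 0 := by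
    refine mul_nonpos_of_nonneg_of_nonpos ?_ (hNsd e)
    rw [← mulVec_mulVec, ← mulVec_mulVec, dotProduct_mulVec, vecMul_transpose]
    exact hθpsd _
  have hPe := hPpos e he
  have hQe := hQpos e he
  rcases le_or_gt ε 0 with hε0 | hε0
  · nlinarith [mul_nonpos_of_nonpos_of_nonneg hε0 hPe.le]
  · have hee : 0 < e ⬝ᵥ e := by
      simpa using dotProduct_star_self_pos_iff.mpr he
    have hPub := hP.le_iSup_eigenvalues_mul e
    have hQlb := hQ.iInf_eigenvalues_mul_le e
    have hsup : 0 < ⨆ i, hP.eigenvalues i :=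
      pos_of_mul_pos_left (hPe.trans_le hPub) hee.le
    rw [lt_div_iff₀ (by positivity)] at hε
    have hlin : 2 * ε * (e ⬝ᵥ (P *ᵥ e)) < e ⬝ᵥ (Q *ᵥ e) :=
      calc 2 * ε * (e ⬝ᵥ (P *ᵥ e))
          ≤ 2 * ε * ((⨆ i, hP.eigenvalues i) * (e ⬝ᵥ e)) := by gcongr
        _ = ε * (2 * ⨆ i, hP.eigenvalues i) * (e ⬝ᵥ e) := by ring
        _ < (⨅ i, hQ.eigenvalues i) * (e ⬝ᵥ e) := by gcongr
        _ ≤ e ⬝ᵥ (Q *ᵥ e) := hQlb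
    linarith
end

section
/- Let A be a real n×n matrix, B a real n×p matrix, K a real p×n matrix, C a real m×n matrix, L and N real n×m matrices, θ a symmetric positive semidefinite real m×m matrix, and P₁, P symmetric positive definite real n×n matrices such that P*N*C + Cᵀ*Nᵀ*P is negative semidefinite and the 2n×2n block matrix Ψ = fromBlocks ((A − B*K)ᵀP₁ + P₁*(A − B*K)) (P₁*B*K) (Kᵀ*Bᵀ*P₁) ((A − L*C)ᵀP + P*(A − L*C)) is negative definite. Then for every pair (x, e) ∈ ℝ^n × ℝ^n with (x, e) ≠ (0, 0): x ⬝ᵥ (((A − B*K)ᵀP₁ + P₁*(A − B*K)) *ᵥ x) + 2 * (x ⬝ᵥ ((P₁*B*K) *ᵥ e)) + e ⬝ᵥ (((A − L*C)ᵀP + P*(A − L*C)) *ᵥ e) + (e ⬝ᵥ ((Cᵀ*θ*C) *ᵥ e)) * (e ⬝ᵥ ((P*N*C + Cᵀ*Nᵀ*P) *ᵥ e)) < 0. (Theorem 6: the Lyapunov derivative of the closed loop under linear state feedback u = −K x̂ with a cubic observer is strictly negative whenever (25) holds.) -/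
open Matrix

theorem dotProduct_transpose_mulVec_comm {ι κ R : Type*} [Fintype ι] [Fintype κ]
    [CommSemiring R] (M : Matrix ι κ R) (x : ι → R) (e : κ → R) :
    e ⬝ᵥ (Mᵀ *ᵥ x) = x ⬝ᵥ (M *ᵥ e) := by
  rw [mulVec_transpose, dotProduct_comm, dotProduct_mulVec]

/-- Theorem 6: if the block matrix (25) is negative definite, then the Lyapunov
derivative of the closed loop (plant + cubic observer + linear feedback) is
strictly negative at every nonzero `(x, e)`. -/
theorem cubic_observer_thm6 {n m p : ℕ}
    (A : Matrix (Fin n) (Fin n) ℝ) (B : Matrix (Fin n) (Fin p) ℝ)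
    (K : Matrix (Fin p) (Fin n) ℝ) (C : Matrix (Fin m) (Fin n) ℝ)
    (L N : Matrix (Fin n) (Fin m) ℝ) (θ : Matrix (Fin m) (Fin m) ℝ)
    (P₁ P : Matrix (Fin n) (Fin n) ℝ)
    (hθsymm : θᵀ = θ)
    (hθpsd : ∀ w : Fin m → ℝ, 0 ≤ w ⬝ᵥ (θ *ᵥ w))
    (hP₁symm : P₁ᵀ = P₁)
    (hP₁pos : ∀ v : Fin n → ℝ, v ≠ 0 → 0 < v ⬝ᵥ (P₁ *ᵥ v))
    (hPsymm : Pᵀ = P)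
    (hPpos : ∀ v : Fin n → ℝ, v ≠ 0 → 0 < v ⬝ᵥ (P *ᵥ v))
    (hNsd : ∀ v : Fin n → ℝ, v ⬝ᵥ ((P * N * C + Cᵀ * Nᵀ * P) *ᵥ v) ≤ 0)
    (hΨ : ∀ v : (Fin n ⊕ Fin n) → ℝ, v ≠ 0 →
      v ⬝ᵥ ((Matrix.fromBlocks
        ((A - B * K)ᵀ * P₁ + P₁ * (A - B * K)) (P₁ * B * K)
        (Kᵀ * Bᵀ * P₁) ((A - L * C)ᵀ * P + P * (A - L * C))) *ᵥ v) < 0) :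
    ∀ x e : Fin n → ℝ, (x, e) ≠ (0, 0) →
      x ⬝ᵥ (((A - B * K)ᵀ * P₁ + P₁ * (A - B * K)) *ᵥ x) +
        2 * (x ⬝ᵥ ((P₁ * B * K) *ᵥ e)) +
        e ⬝ᵥ (((A - L * C)ᵀ * P + P * (A - L * C)) *ᵥ e) +
        (e ⬝ᵥ ((Cᵀ * θ * C) *ᵥ e)) * (e ⬝ᵥ ((P * N * C + Cᵀ * Nᵀ * P) *ᵥ e))
      < 0 := by
  intro x e hxe
  have hv : Sum.elim x e ≠ 0 := by
    intro h
    apply hxe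
    ext i
    · exact congrFun h (Sum.inl i)
    · exact congrFun h (Sum.inr i)
  have hlin := hΨ (Sum.elim x e) hv
  have hoff : e ⬝ᵥ ((Kᵀ * Bᵀ * P₁) *ᵥ x) = x ⬝ᵥ ((P₁ * B * K) *ᵥ e) := by
    rw [← dotProduct_transpose_mulVec_comm]
    simp only [transpose_mul, transpose_transpose, hP₁symm, Matrix.mul_assoc]
  have hθe : 0 ≤ e ⬝ᵥ ((Cᵀ * θ * C) *ᵥ e) := by
    have h := hθpsd (C *ᵥ e)
    rwa [dotProduct_comm, ← dotProduct_transpose_mulVec_comm, mulVec_mulVec,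
      mulVec_mulVec] at h
  have hcubic := mul_nonpos_of_nonneg_of_nonpos hθe (hNsd e)
  rw [fromBlocks_mulVec, sumElim_dotProduct_sumElim, Sum.elim_comp_inl,
    Sum.elim_comp_inr, dotProduct_add, dotProduct_add, hoff] at hlin
  linarith
end

section
/- Let A be a real n×n matrix, B a real n×p matrix, K a real p×n matrix, C a real m×n matrix, L and N real n×m matrices, θ a symmetric positive semidefinite real m×m matrix, and P₁, P symmetric positive definite real n×n matrices such that P*N*C + Cᵀ*Nᵀ*P is negative semidefinite. Suppose the linear closed loop with a linear observer is quadratically stable, i.e. the matrix A_aᵀ*P_a + P_a*A_a is negative definite, where A_a = fromBlocks (A − B*K) (B*K) 0 (A − L*C) and P_a = fromBlocks P₁ 0 0 P. Then the cubic-observer closed loop is stable in the same Lyapunov sense: for every (x, e) ∈ ℝ^n × ℝ^n with (x, e) ≠ (0, 0), x ⬝ᵥ (((A − B*K)ᵀP₁ + P₁*(A − B*K)) *ᵥ x) + 2 * (x ⬝ᵥ ((P₁*B*K) *ᵥ e)) + e ⬝ᵥ (((A − L*C)ᵀP + P*(A − L*C)) *ᵥ e) + (e ⬝ᵥ ((Cᵀ*θ*C)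 *ᵥ e)) * (e ⬝ᵥ ((P*N*C + Cᵀ*Nᵀ*P) *ᵥ e)) < 0. (Corollary 1: stability of linear feedback with a linear observer implies stability of linear feedback with the cubic observer.) -/
open Matrix

/-- The Lyapunov form of a block upper triangular matrix with respect to a block diagonal one,
split into its blocks. -/
theorem dotProduct_transpose_fromBlocks_mul_add_mulVec {ι κ : Type*} [Fintype ι] [Fintype κ]
    (F : Matrix ι ι ℝ) (G : Matrix ι κ ℝ) (H : Matrix κ κ ℝ) (P : Matrix ι ι ℝ)
    (Q : Matrix κ κ ℝ) (hP : Pᵀ = P) (x : ι → ℝ) (e : κ → ℝ) :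
    Sum.elim x e ⬝ᵥ (((fromBlocks F G 0 H)ᵀ * fromBlocks P 0 0 Q +
        fromBlocks P 0 0 Q * fromBlocks F G 0 H) *ᵥ Sum.elim x e) =
      x ⬝ᵥ ((Fᵀ * P + P * F) *ᵥ x) + 2 * (x ⬝ᵥ ((P * G) *ᵥ e)) +
        e ⬝ᵥ ((Hᵀ * Q + Q * H) *ᵥ e) := by
  have hcross : e ⬝ᵥ ((Gᵀ * P) *ᵥ x) = x ⬝ᵥ ((P * G) *ᵥ e) := by
    rw [dotProduct_mulVec, ← mulVec_transpose, transpose_mul, transpose_transpose, hP,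
      dotProduct_comm]
  simp only [fromBlocks_transpose, fromBlocks_multiply, fromBlocks_add, fromBlocks_mulVec,
    Sum.elim_comp_inl, Sum.elim_comp_inr, sumElim_dotProduct_sumElim, dotProduct_add,
    Matrix.mul_zero, Matrix.zero_mul, add_zero, zero_add, transpose_zero, hcross]
  ring

/-- Corollary 1: if the linear closed loop with a linear observer is
quadratically stable (`A_aᵀ P_a + P_a A_a` negative definite), then the
cubic-observer closed loop is stable in the same Lyapunov sense. -/
theorem cubic_observer_corollary1 {n m p : ℕ}
    (A : Matrix (Fin n) (Fin n) ℝ) (B : Matrix (Fin n) (Fin p) ℝ)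
    (K : Matrix (Fin p) (Fin n) ℝ) (C : Matrix (Fin m) (Fin n) ℝ)
    (L N : Matrix (Fin n) (Fin m) ℝ) (θ : Matrix (Fin m) (Fin m) ℝ)
    (P₁ P : Matrix (Fin n) (Fin n) ℝ)
    (hθsymm : θᵀ = θ)
    (hθpsd : ∀ w : Fin m → ℝ, 0 ≤ w ⬝ᵥ (θ *ᵥ w))
    (hP₁symm : P₁ᵀ = P₁)
    (hP₁pos : ∀ v : Fin n → ℝ, v ≠ 0 → 0 < v ⬝ᵥ (P₁ *ᵥ v))
    (hPsymm : Pᵀ = P)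
    (hPpos : ∀ v : Fin n → ℝ, v ≠ 0 → 0 < v ⬝ᵥ (P *ᵥ v))
    (hNsd : ∀ v : Fin n → ℝ, v ⬝ᵥ ((P * N * C + Cᵀ * Nᵀ * P) *ᵥ v) ≤ 0)
    (hlin : ∀ v : (Fin n ⊕ Fin n) → ℝ, v ≠ 0 →
      v ⬝ᵥ (((Matrix.fromBlocks (A - B * K) (B * K) 0 (A - L * C))ᵀ *
          (Matrix.fromBlocks P₁ 0 0 P) +
        (Matrix.fromBlocks P₁ 0 0 P) *
          (Matrix.fromBlocks (A - B * K) (B * K) 0 (A - L * C))) *ᵥ v) < 0) :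
    ∀ x e : Fin n → ℝ, (x, e) ≠ (0, 0) →
      x ⬝ᵥ (((A - B * K)ᵀ * P₁ + P₁ * (A - B * K)) *ᵥ x) +
        2 * (x ⬝ᵥ ((P₁ * B * K) *ᵥ e)) +
        e ⬝ᵥ (((A - L * C)ᵀ * P + P * (A - L * C)) *ᵥ e) +
        (e ⬝ᵥ ((Cᵀ * θ * C) *ᵥ e)) * (e ⬝ᵥ ((P * N * C + Cᵀ * Nᵀ * P) *ᵥ e))
      < 0 := by
  intro x e hxe
  have hv : Sum.elim x e ≠ 0 := by
    intro h
    apply hxe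
    rw [Prod.mk.injEq]
    exact ⟨funext fun i => congrFun h (Sum.inl i), funext fun i => congrFun h (Sum.inr i)⟩
  have hquad := hlin _ hv
  rw [dotProduct_transpose_fromBlocks_mul_add_mulVec _ _ _ _ _ hP₁symm,
    ← Matrix.mul_assoc] at hquad
  have hθ : 0 ≤ e ⬝ᵥ ((Cᵀ * θ * C) *ᵥ e) := by
    rw [← mulVec_mulVec, ← mulVec_mulVec, dotProduct_mulVec, vecMul_transpose]
    exact hθpsd (C *ᵥ e)
  linarith [mul_nonpos_of_nonneg_of_nonpos hθ (hNsd e)]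
end
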